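/- arXiv:1007.1260 — 4 statements merged into one kernel-verified Lean document; each statement's English description precedes it below -/
import Mathlib

section
/- Let ξ ∈ (0,1) and φ ∈ (0,1). Let T be a finite multiset of reals in [φ, 1], and let A and B be finite multisets of reals in (0, φ). Suppose Σ_{a∈A} a + Σ_{a∈T} a ≤ (1+ξ)·(Σ_{a∈B} a + Σ_{a∈T} a) and Σ_{a∈B} a + Σ_{a∈T} a ≤ (1+ξ)·(Σ_{a∈A} a + Σ_{a∈T} a). Then Opt(A ∪ T) ≤ ((1+ξ)/(1−φ))·Opt(B ∪ T) + 1 and Opt(B ∪ T) ≤ ((1+ξ)/(1−φ))·Opt(A ∪ T) + 1. -/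
/-- `P` is a packing of the multiset `L` of items into bins of size 1:
it partitions `L` into sub-multisets, each of total sum at most 1. -/
def IsBinPacking (L : Multiset ℝ) (P : Multiset (Multiset ℝ)) : Prop :=
  P.join = L ∧ ∀ b ∈ P, b.sum ≤ 1

/-- `binOpt L` is the minimum number of bins of size 1 needed to pack `L`. -/
noncomputable def binOpt (L : Multiset ℝ) : ℕ :=
  sInf {N | ∃ P : Multiset (Multiset ℝ), IsBinPacking L P ∧ P.card = N}

theorem binOpt_le_card {L : Multiset ℝ} {P : Multiset (Multiset ℝ)} (h : IsBinPacking L P) :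
    binOpt L ≤ P.card := Nat.sInf_le ⟨P, h, rfl⟩

theorem exists_packing (L : Multiset ℝ) (hL : ∀ x ∈ L, x ≤ 1) :
    ∃ P, IsBinPacking L P ∧ P.card = binOpt L := by
  have hne : {N | ∃ P : Multiset (Multiset ℝ), IsBinPacking L P ∧ P.card = N}.Nonempty := by
    refine ⟨_, L.map (fun x => {x}), ⟨?_, ?_⟩, rfl⟩
    · induction L using Multiset.induction_on with
      | empty => simp
      | cons a s ih =>
        simp only [Multiset.map_cons, Multiset.join_cons]
        rw [ih (fun x hx => hL x (Multiset.mem_cons_of_mem hx))]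
        simp
    · intro b hb
      obtain ⟨x, hx, rfl⟩ := Multiset.mem_map.1 hb
      simpa using hL x hx
  exact Nat.sInf_mem hne

theorem join_sum_le (P : Multiset (Multiset ℝ)) (h : ∀ b ∈ P, b.sum ≤ 1) :
    P.join.sum ≤ P.card := by
  induction P using Multiset.induction_on with
  | empty => simp
  | cons a s ih =>
    have h1 := h a (Multiset.mem_cons_self a s)
    have h2 := ih (fun x hx => h x (Multiset.mem_cons_of_mem hx))
    simp only [Multiset.join_cons, Multiset.sum_add, Multiset.card_cons]
    push_cast
    linarith

theorem le_join_sum (c : ℝ) (P : Multiset (Multiset ℝ)) (h : ∀ b ∈ P, c < b.sum) :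
    P.card * c ≤ P.join.sum := by
  induction P using Multiset.induction_on with
  | empty => simp
  | cons a s ih =>
    have h1 := h a (Multiset.mem_cons_self a s)
    have h2 := ih (fun x hx => h x (Multiset.mem_cons_of_mem hx))
    simp only [Multiset.join_cons, Multiset.sum_add, Multiset.card_cons]
    push_cast
    linarith

theorem join_map_filter_ge (φ : ℝ) (P : Multiset (Multiset ℝ)) :
    (P.map (Multiset.filter (fun x => φ ≤ x))).join = P.join.filter (fun x => φ ≤ x) := by
  induction P using Multiset.induction_on with
  | empty => simp
  | cons a s ih => simp [ih]

theorem filter_sum_le (φ : ℝ) (b : Multiset ℝ) (h : ∀ x ∈ b, 0 < x) :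
    (b.filter (fun x => φ ≤ x)).sum ≤ b.sum := by
  have e := congrArg Multiset.sum (Multiset.filter_add_not (fun x => φ ≤ x) b)
  rw [Multiset.sum_add] at e
  have : 0 ≤ (b.filter (fun x => ¬ φ ≤ x)).sum :=
    Multiset.sum_nonneg (fun x hx => (h x (Multiset.mem_of_mem_filter hx)).le)
  linarith

theorem greedy (φ : ℝ) (hφ1 : φ < 1) (T : Multiset ℝ) (P : Multiset (Multiset ℝ))
    (hP : IsBinPacking T P) (A : Multiset ℝ) (hA : ∀ x ∈ A, 0 < x ∧ x < φ) :
    ∃ Q, IsBinPacking (A + T) Q ∧ (Q.card ≤ P.card ∨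
      ∃ b Q', Q = b ::ₘ Q' ∧ ∀ c ∈ Q', 1 - φ < c.sum) := by
  induction A using Multiset.induction_on with
  | empty => exact ⟨P, by simpa using hP, Or.inl le_rfl⟩
  | cons a s ih =>
    obtain ⟨Q, ⟨hQ1, hQ2⟩, hQ3⟩ := ih (fun x hx => hA x (Multiset.mem_cons_of_mem hx))
    have ha := hA a (Multiset.mem_cons_self a s)
    by_cases hlow : ∃ b ∈ Q, b.sum ≤ 1 - φ
    · obtain ⟨b, hb, hbs⟩ := hlow
      obtain ⟨R, rfl⟩ := Multiset.exists_cons_of_mem hb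
      refine ⟨(a ::ₘ b) ::ₘ R, ⟨?_, ?_⟩, ?_⟩
      · simp only [Multiset.join_cons, Multiset.cons_add] at hQ1 ⊢
        rw [hQ1]
      · intro c hc
        rcases Multiset.mem_cons.1 hc with rfl | hc
        · rw [Multiset.sum_cons]; linarith
        · exact hQ2 c (Multiset.mem_cons_of_mem hc)
      · rcases hQ3 with h | ⟨b', Q', he, hQ'⟩
        · left; simpa using h
        · right
          refine ⟨_, R, rfl, ?_⟩
          have hbb : b = b' := by
            have : b ∈ b' ::ₘ Q' := he ▸ hb
            rcases Multiset.mem_cons.1 this with h | h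
            · exact h
            · exact absurd (hQ' b h) (not_lt.2 hbs)
          subst hbb
          rw [Multiset.cons_inj_right] at he
          rw [he]; exact hQ'
    · push Not at hlow
      refine ⟨{a} ::ₘ Q, ⟨?_, ?_⟩, Or.inr ⟨_, Q, rfl, hlow⟩⟩
      · simp [hQ1]
      · intro c hc
        rcases Multiset.mem_cons.1 hc with rfl | hc
        · rw [Multiset.sum_singleton]; linarith
        · exact hQ2 c hc

theorem exchange_one (ξ φ : ℝ)
    (hξ : ξ ∈ Set.Ioo (0 : ℝ) 1) (hφ : φ ∈ Set.Ioo (0 : ℝ) 1)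
    (T A B : Multiset ℝ)
    (hT : ∀ x ∈ T, φ ≤ x ∧ x ≤ 1)
    (hA : ∀ x ∈ A, 0 < x ∧ x < φ) (hB : ∀ x ∈ B, 0 < x ∧ x < φ)
    (h1 : A.sum + T.sum ≤ (1 + ξ) * (B.sum + T.sum)) :
    (binOpt (A + T) : ℝ) ≤ (1 + ξ) / (1 - φ) * binOpt (B + T) + 1 := by
  obtain ⟨hξ0, hξ1⟩ := hξ
  obtain ⟨hφ0, hφ1⟩ := hφ
  obtain ⟨P, ⟨hP1, hP2⟩, hPc⟩ := exists_packing (B + T) (by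
    intro x hx
    rcases Multiset.mem_add.1 hx with h | h
    · linarith [(hB x h).2]
    · exact (hT x h).2)
  have hsum := join_sum_le P hP2
  rw [hP1, Multiset.sum_add] at hsum
  have hpack : IsBinPacking T (P.map (Multiset.filter (fun x => φ ≤ x))) := by
    constructor
    · rw [join_map_filter_ge, hP1, Multiset.filter_add,
        Multiset.filter_eq_nil.2 (fun x hx => not_le.2 (hB x hx).2),
        Multiset.filter_eq_self.2 (fun x hx => (hT x hx).1), zero_add]
    · intro c hc
      obtain ⟨b, hb, rfl⟩ := Multiset.mem_map.1 hc
      refine (filter_sum_le φ b ?_).trans (hP2 b hb)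
      intro x hx
      have : x ∈ B + T := hP1 ▸ Multiset.mem_join.2 ⟨b, hb, hx⟩
      rcases Multiset.mem_add.1 this with h | h
      · exact (hB x h).1
      · linarith [(hT x h).1]
  obtain ⟨Q, hQ, hQ3⟩ := greedy φ hφ1 T _ hpack A hA
  have hle : (binOpt (A + T) : ℝ) ≤ Q.card := by exact_mod_cast binOpt_le_card hQ
  rw [← hPc]
  have hpos : 0 < 1 - φ := by linarith
  have hn : (0 : ℝ) ≤ P.card := Nat.cast_nonneg _
  refine hle.trans ?_
  rcases hQ3 with h | ⟨b, Q', rfl, hQ'⟩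
  · rw [Multiset.card_map] at h
    have h' : (Q.card : ℝ) ≤ P.card := by exact_mod_cast h
    have : 1 ≤ (1 + ξ) / (1 - φ) := by rw [le_div_iff₀ hpos]; linarith
    nlinarith
  · have e := hQ.1
    have hb : 0 ≤ b.sum := by
      refine Multiset.sum_nonneg (fun x hx => ?_)
      have : x ∈ A + T := e ▸ Multiset.mem_join.2 ⟨b, Multiset.mem_cons_self _ _, hx⟩
      rcases Multiset.mem_add.1 this with h | h
      · exact (hA x h).1.le
      · linarith [(hT x h).1]
    have e2 := congrArg Multiset.sum e
    rw [Multiset.join_cons, Multiset.sum_add, Multiset.sum_add] at e2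
    have h3 := le_join_sum _ Q' hQ'
    have h4 : (Q'.card : ℝ) ≤ (1 + ξ) / (1 - φ) * P.card := by
      rw [div_mul_eq_mul_div, le_div_iff₀ hpos]
      nlinarith
    rw [Multiset.card_cons]
    push_cast
    linarith

theorem small_items_exchange (ξ φ : ℝ)
    (hξ : ξ ∈ Set.Ioo (0 : ℝ) 1) (hφ : φ ∈ Set.Ioo (0 : ℝ) 1)
    (T A B : Multiset ℝ)
    (hT : ∀ x ∈ T, φ ≤ x ∧ x ≤ 1)
    (hA : ∀ x ∈ A, 0 < x ∧ x < φ) (hB : ∀ x ∈ B, 0 < x ∧ x < φ)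
    (h1 : A.sum + T.sum ≤ (1 + ξ) * (B.sum + T.sum))
    (h2 : B.sum + T.sum ≤ (1 + ξ) * (A.sum + T.sum)) :
    (binOpt (A + T) : ℝ) ≤ (1 + ξ) / (1 - φ) * binOpt (B + T) + 1 ∧
    (binOpt (B + T) : ℝ) ≤ (1 + ξ) / (1 - φ) * binOpt (A + T) + 1 := by
  exact ⟨exchange_one ξ φ hξ hφ T A B hT hA hB h1, exchange_one ξ φ hξ hφ T B A hT hB hA h2⟩
end

section
/- Let δ ∈ (0,1). Let T be a finite multiset of reals in [δ, 1] and A a finite multiset of reals in (0, δ). If T can be packed into N bins (that is, Opt(T) ≤ N for a natural number N), then Opt(T ∪ A) ≤ max(N, (Σ_{a ∈ T∪A} a)/(1−δ) + 1). -/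
theorem fill_aux (δ : ℝ) (hδ : δ ∈ Set.Ioo (0 : ℝ) 1)
    (T : Multiset ℝ) (N : ℕ) (P₀ : Multiset (Multiset ℝ)) (hP₀ : IsBinPacking T P₀)
    (hc : P₀.card ≤ N) (A : Multiset ℝ) (hA : ∀ x ∈ A, 0 < x ∧ x < δ) :
    ∃ P : Multiset (Multiset ℝ), IsBinPacking (T + A) P ∧
      (P.card ≤ N ∨ ((P.card : ℝ) - 1) * (1 - δ) ≤ (T + A).sum) := by
  induction A using Multiset.induction_on with
  | empty => exact ⟨P₀, by simpa using hP₀, Or.inl hc⟩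
  | cons a A ih =>
    obtain ⟨P, ⟨hj, hs⟩, hP⟩ := ih (fun x hx => hA x (Multiset.mem_cons_of_mem hx))
    obtain ⟨ha0, haδ⟩ := hA a (Multiset.mem_cons_self a A)
    by_cases hb : ∃ b ∈ P, b.sum + a ≤ 1
    · obtain ⟨b, hbP, hba⟩ := hb
      obtain ⟨Q, rfl⟩ := Multiset.exists_cons_of_mem hbP
      refine ⟨(a ::ₘ b) ::ₘ Q, ⟨?_, ?_⟩, ?_⟩
      · rw [Multiset.add_cons, ← hj]
        simp
      · intro c hcm
        rcases Multiset.mem_cons.1 hcm with rfl | h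
        · rw [Multiset.sum_cons]; linarith
        · exact hs c (Multiset.mem_cons_of_mem h)
      · rcases hP with h | h
        · left; simpa using h
        · right
          rw [Multiset.add_cons, Multiset.sum_cons]
          rw [Multiset.card_cons] at h ⊢
          linarith
    · push Not at hb
      refine ⟨{a} ::ₘ P, ⟨?_, ?_⟩, Or.inr ?_⟩
      · rw [Multiset.add_cons, ← hj]
        simp
      · intro c hcm
        rcases Multiset.mem_cons.1 hcm with rfl | h
        · rw [Multiset.sum_singleton]; linarith [hδ.2]
        · exact hs c h
      · have key : (P.card : ℝ) * (1 - δ) ≤ P.join.sum := by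
          rw [Multiset.sum_join]
          have := Multiset.card_nsmul_le_sum (s := P.map Multiset.sum) (a := 1 - δ) (by
            intro x hx
            obtain ⟨b, hbP, rfl⟩ := Multiset.mem_map.1 hx
            linarith [hb b hbP])
          simpa using this
        rw [Multiset.add_cons, Multiset.sum_cons, Multiset.card_cons, ← hj]
        push_cast
        linarith

theorem fill_small_items (δ : ℝ) (hδ : δ ∈ Set.Ioo (0 : ℝ) 1)
    (T A : Multiset ℝ)
    (hT : ∀ x ∈ T, δ ≤ x ∧ x ≤ 1) (hA : ∀ x ∈ A, 0 < x ∧ x < δ)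
    (N : ℕ) (hN : binOpt T ≤ N) :
    (binOpt (T + A) : ℝ) ≤ max (N : ℝ) ((T + A).sum / (1 - δ) + 1) := by
  have hne : {N | ∃ P : Multiset (Multiset ℝ), IsBinPacking T P ∧ P.card = N}.Nonempty := by
    refine ⟨_, T.map (fun x => {x}), ⟨?_, ?_⟩, rfl⟩
    · rw [← Multiset.bind, Multiset.bind_singleton, Multiset.map_id']
    · intro b hb
      obtain ⟨x, hx, rfl⟩ := Multiset.mem_map.1 hb
      simpa using (hT x hx).2
  obtain ⟨P₀, hP₀, hc⟩ := Nat.sInf_mem hne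
  obtain ⟨P, hP, h⟩ := fill_aux δ hδ T N P₀ hP₀ (hc.trans_le hN) A hA
  have hle : binOpt (T + A) ≤ P.card := Nat.sInf_le ⟨P, hP, rfl⟩
  have hle' : (binOpt (T + A) : ℝ) ≤ P.card := by exact_mod_cast hle
  refine hle'.trans ?_
  rcases h with h | h
  · exact le_max_of_le_left (by exact_mod_cast h)
  · apply le_max_of_le_right
    have := (le_div_iff₀ (by linarith [hδ.2] : (0 : ℝ) < 1 - δ)).2 h
    linarith
end

section
/- Let δ, ξ ∈ (0, 1/4]. Let S be a finite multiset of reals in (0,1] with total size W = Σ_{a∈S} a satisfying 2 < δ·W. Let n_L = #{a ∈ S : a ≥ δ} and Σ_L = Σ_{a∈S, a≥δ} a. Let x be a real with n_L ≤ x ≤ ξ·W, and let s₁ ≥ 0 be a real with W ≤ (1+ξ)·(s₁ + Σ_L) and s₁ + Σ_L ≤ (1+ξ)·W. Let k be the least natural number with k·(1−δ) ≥ s₁, and set app = ((1+ξ)/(1−δ))·(k + x + 1). Then Opt(S) ≤ app ≤ (1 + 8(δ+ξ))·Opt(S). -/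
lemma greedy_aux (δ : ℝ) (h1 : δ ≤ 1) (T : Multiset ℝ) :
    (∀ a ∈ T, 0 < a ∧ a ≤ δ) → ∃ (b : Multiset ℝ) (Q : Multiset (Multiset ℝ)),
      IsBinPacking T (b ::ₘ Q) ∧ (Q.card : ℝ) * (1 - δ) + b.sum ≤ T.sum := by
  induction T using Multiset.induction_on with
  | empty =>
    intro _
    exact ⟨0, 0, by simp [IsBinPacking], by simp⟩
  | cons a T ih =>
    intro h
    obtain ⟨b, Q, ⟨hj, hb⟩, hc⟩ := ih (fun c hc => h c (Multiset.mem_cons_of_mem hc))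
    obtain ⟨ha0, ha⟩ := h a (Multiset.mem_cons_self a T)
    have hbQ : ∀ c ∈ Q, c.sum ≤ 1 := fun c hc => hb c (Multiset.mem_cons_of_mem hc)
    by_cases hle : a + b.sum ≤ 1
    · refine ⟨a ::ₘ b, Q, ⟨?_, ?_⟩, ?_⟩
      · rw [← hj]; simp
      · intro c hc'
        rcases Multiset.mem_cons.1 hc' with rfl | hc'
        · simpa using hle
        · exact hbQ c hc'
      · simp only [Multiset.sum_cons]; linarith
    · refine ⟨{a}, b ::ₘ Q, ⟨?_, ?_⟩, ?_⟩
      · rw [← hj]; simp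
      · intro c hc'
        rcases Multiset.mem_cons.1 hc' with rfl | hc'
        · simp; linarith
        · exact hb c hc'
      · simp only [Multiset.sum_cons, Multiset.card_cons, Multiset.sum_singleton]
        push_cast
        push Not at hle
        nlinarith

lemma single_aux (T : Multiset ℝ) :
    (∀ a ∈ T, a ≤ 1) → IsBinPacking T (T.map (fun a => {a})) := by
  intro h
  refine ⟨?_, ?_⟩
  · induction T using Multiset.induction_on with
    | empty => simp
    | cons a T ih =>
      simp only [Multiset.map_cons, Multiset.join_cons]
      rw [ih (fun c hc => h c (Multiset.mem_cons_of_mem hc))]; simp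
  · intro b hb
    obtain ⟨a, ha, rfl⟩ := Multiset.mem_map.1 hb
    simpa using h a ha

lemma sum_le_card_aux (P : Multiset (Multiset ℝ)) :
    (∀ b ∈ P, b.sum ≤ 1) → P.join.sum ≤ P.card := by
  induction P using Multiset.induction_on with
  | empty => simp
  | cons b P ih =>
    intro h
    have := ih (fun c hc => h c (Multiset.mem_cons_of_mem hc))
    have := h b (Multiset.mem_cons_self b P)
    simp only [Multiset.join_cons, Multiset.sum_add, Multiset.card_cons]
    push_cast
    linarith

lemma sum_le_card_aux' (T : Multiset ℝ) : (∀ a ∈ T, a ≤ 1) → T.sum ≤ T.card := by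
  intro h
  have := Multiset.sum_le_card_nsmul T 1 h
  simpa using this

theorem packing_with_few_large_items (δ ξ : ℝ)
    (hδ : 0 < δ ∧ δ ≤ 1 / 4) (hξ : 0 < ξ ∧ ξ ≤ 1 / 4)
    (S : Multiset ℝ) (hS : ∀ x ∈ S, 0 < x ∧ x ≤ 1)
    (hW : 2 < δ * S.sum)
    (x s₁ : ℝ)
    (hx1 : (((S.filter (fun a => δ ≤ a)).card : ℝ)) ≤ x) (hx2 : x ≤ ξ * S.sum)
    (hs₁ : 0 ≤ s₁)
    (hsum1 : S.sum ≤ (1 + ξ) * (s₁ + (S.filter (fun a => δ ≤ a)).sum))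
    (hsum2 : s₁ + (S.filter (fun a => δ ≤ a)).sum ≤ (1 + ξ) * S.sum)
    (k : ℕ) (hk : s₁ ≤ (k : ℝ) * (1 - δ))
    (hkmin : ∀ k' : ℕ, s₁ ≤ (k' : ℝ) * (1 - δ) → k ≤ k') :
    (binOpt S : ℝ) ≤ (1 + ξ) / (1 - δ) * ((k : ℝ) + x + 1) ∧
    (1 + ξ) / (1 - δ) * ((k : ℝ) + x + 1) ≤ (1 + 8 * (δ + ξ)) * binOpt S := by
  obtain ⟨hδ0, hδ1⟩ := hδ
  obtain ⟨hξ0, hξ1⟩ := hξ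
  have hd : 0 < 1 - δ := by linarith
  set A := S.filter (fun a => δ ≤ a) with hA
  set B := S.filter (fun a => ¬ δ ≤ a) with hB
  have hAB : A + B = S := Multiset.filter_add_not _ _
  have hABs : A.sum + B.sum = S.sum := by rw [← Multiset.sum_add, hAB]
  have hA1 : ∀ a ∈ A, a ≤ 1 := fun a ha => (hS a (Multiset.mem_of_mem_filter ha)).2
  have hAc := sum_le_card_aux' A hA1
  have hA0 : 0 ≤ A.sum := Multiset.sum_nonneg
    (fun a ha => (hS a (Multiset.mem_of_mem_filter ha)).1.le)
  obtain ⟨b, Q, ⟨hj, hbQ⟩, hc⟩ := greedy_aux δ (by linarith) B (fun a ha =>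
    ⟨(hS a (Multiset.mem_of_mem_filter ha)).1, (not_le.1 (Multiset.mem_filter.1 ha).2).le⟩)
  obtain ⟨hsj, hsb⟩ := single_aux A hA1
  have hb0 : 0 ≤ b.sum := by
    apply Multiset.sum_nonneg
    intro a ha
    have : a ∈ B := by rw [← hj]; simp [ha]
    exact (hS a (Multiset.mem_of_mem_filter this)).1.le
  have hmem : A.card + (Q.card + 1) ∈
      {N | ∃ P : Multiset (Multiset ℝ), IsBinPacking S P ∧ P.card = N} := by
    refine ⟨A.map (fun a => {a}) + b ::ₘ Q, ⟨?_, ?_⟩, ?_⟩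
    · rw [Multiset.join_add, hsj, hj, hAB]
    · intro c hc
      rcases Multiset.mem_add.1 hc with hc | hc
      · exact hsb c hc
      · exact hbQ c hc
    · simp [add_assoc]
  have hopt : binOpt S ≤ A.card + (Q.card + 1) := Nat.sInf_le hmem
  have hoptR : (binOpt S : ℝ) ≤ A.card + (Q.card + 1) := by exact_mod_cast hopt
  have hlow : S.sum ≤ (binOpt S : ℝ) := by
    obtain ⟨P, ⟨hP, hP1⟩, hPc⟩ := Nat.sInf_mem ⟨_, hmem⟩
    have := sum_le_card_aux P hP1
    rw [hP, hPc] at this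
    exact this
  have hW0 : 0 < S.sum := by
    by_contra h
    push Not at h
    nlinarith
  have hk2 : (k : ℝ) * (1 - δ) ≤ s₁ + (1 - δ) := by
    rcases Nat.eq_zero_or_pos k with h0 | h0
    · subst h0; push_cast; linarith
    · by_contra h
      push Not at h
      have h2 := hkmin (k - 1) (by rw [Nat.cast_sub h0]; push_cast; linarith)
      omega
  constructor
  · refine hoptR.trans ?_
    rw [div_mul_eq_mul_div, le_div_iff₀ hd]
    have hk0 : (0 : ℝ) ≤ k := Nat.cast_nonneg k
    have hn0 : (0 : ℝ) ≤ A.card := Nat.cast_nonneg _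
    have e1 : (1 + ξ) * s₁ ≤ (1 + ξ) * (k * (1 - δ)) := by gcongr
    have e2 : ξ * A.sum ≤ ξ * A.card := by gcongr
    have e3 : (1 + ξ) * (A.card : ℝ) ≤ (1 + ξ) * x := by gcongr
    have e4 : 0 ≤ (1 + ξ) * (k * δ) := by positivity
    have e5 : 0 ≤ (A.card : ℝ) * δ := by positivity
    nlinarith
  · have hW2 : (1 + ξ) / (1 - δ) * ((k : ℝ) + x + 1) ≤ (1 + 8 * (δ + ξ)) * S.sum := by
      rw [div_mul_eq_mul_div, div_le_iff₀ hd]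
      have f1 : ((k : ℝ) + x + 1) * (1 - δ) ≤ ((1 + ξ) + (δ + ξ) * (1 - δ)) * S.sum := by
        nlinarith
      have f2 : (1 + ξ) * ((1 + ξ) + (δ + ξ) * (1 - δ)) ≤ (1 + 8 * (δ + ξ)) * (1 - δ) * (1 - δ) := by
        have g : (9:ℝ)/16 ≤ (1 - δ) * (1 - δ) := by nlinarith
        have g2 : 8 * (δ + ξ) * (9/16) ≤ 8 * (δ + ξ) * ((1 - δ) * (1 - δ)) := by gcongr
        nlinarith [mul_pos hδ0 hξ0, mul_pos hδ0 hδ0]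
      have f3 := mul_le_mul_of_nonneg_left f1 (by linarith : 0 ≤ 1 + ξ)
      have f4 := mul_le_mul_of_nonneg_right f2 hW0.le
      refine le_of_mul_le_mul_right ?_ hd
      nlinarith
    refine hW2.trans ?_
    gcongr
end

section
/- Let 0 < c ≤ 1, 0 < η ≤ 1, and let (s_1, w_1), ..., (s_k, w_k) be k ≥ 1 bin types with c ≤ s_i ≤ 1 and η ≤ w_i ≤ 1 for all i. Let 0 < δ₁ ≤ δ₂ < c and ε₁ > 0. Let S be a finite multiset of reals in (0,1] satisfying the (δ₁, δ₂, ε₁)-property: ⌈(δ₂/(c−δ₂))·#{a ∈ S : a ≤ δ₂}⌉ ≤ ε₁·η·δ₁·#{a ∈ S : a ≥ δ₁}. Let S_{≥δ₁} denote the sub-multiset of elements of S of size at least δ₁. Then Opt_{c,η,k}(S_{≥δ₁}) ≤ Opt_{c,η,k}(S) ≤ (1+ε₁)·Opt_{c,η,k}(S_{≥δ₁}) + 1. -/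
open scoped ENNReal

/-- `P` is a packing of the multiset `L` of items into bins drawn from `k` bin types of
sizes `s 0, …, s (k-1)`: each bin is a pair (type, contents), the contents of all bins
partition `L`, and the contents of a bin of type `i` have total sum at most `s i`. -/
def IsRelPacking (k : ℕ) (s : Fin k → ℝ) (L : Multiset ℝ)
    (P : Multiset (Fin k × Multiset ℝ)) : Prop :=
  (P.map Prod.snd).join = L ∧ ∀ p ∈ P, p.2.sum ≤ s p.1

/-- `relOpt k s w L` is the minimum total cost (sum of the costs `w` of the types of the
bins used) over all packings of `L` into bins of the `k` given types; it is `∞` when no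
packing exists. -/
noncomputable def relOpt (k : ℕ) (s w : Fin k → ℝ) (L : Multiset ℝ) : ℝ≥0∞ :=
  sInf {x : ℝ≥0∞ | ∃ P : Multiset (Fin k × Multiset ℝ), IsRelPacking k s L P ∧
    x = ENNReal.ofReal ((P.map (fun p => w p.1)).sum)}

lemma rb_filter_join (p : ℝ → Prop) [DecidablePred p] (A : Multiset (Multiset ℝ)) :
    (A.map (fun M => M.filter p)).join = A.join.filter p := by
  induction A using Multiset.induction_on with
  | empty => simp
  | cons a A ih => simp [ih]

lemma rb_filter_sum_le (p : ℝ → Prop) [DecidablePred p] (M : Multiset ℝ)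
    (h : ∀ x ∈ M, 0 < x) : (M.filter p).sum ≤ M.sum := by
  have h1 : (M.filter p).sum + (M.filter (fun a => ¬ p a)).sum = M.sum := by
    rw [← Multiset.sum_add, Multiset.filter_add_not]
  have h2 : 0 ≤ (M.filter (fun a => ¬ p a)).sum :=
    Multiset.sum_nonneg (fun x hx => (h x (Multiset.mem_of_mem_filter hx)).le)
  linarith

lemma rb_greedy (c d : ℝ) (hd : d < c) (L : Multiset ℝ) (hL : ∀ x ∈ L, 0 < x ∧ x ≤ d) :
    ∃ (q : Multiset ℝ) (Q : Multiset (Multiset ℝ)), q + Q.join = L ∧ q.sum ≤ max c 0 ∧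
      (∀ r ∈ Q, r.sum ≤ max c 0) ∧ q.sum + Q.card * (c - d) ≤ L.sum := by
  induction L using Multiset.induction_on with
  | empty => exact ⟨0, 0, by simp, by simp, by simp, by simp⟩
  | cons a L ih =>
    obtain ⟨q, Q, h1, h2, h3, h4⟩ := ih (fun x hx => hL x (Multiset.mem_cons_of_mem hx))
    have ha := hL a (Multiset.mem_cons_self a L)
    by_cases hq : a + q.sum ≤ c
    · refine ⟨a ::ₘ q, Q, by simp [h1], ?_, h3, ?_⟩
      · simp only [Multiset.sum_cons]; exact hq.trans (le_max_left _ _)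
      · simp only [Multiset.sum_cons]; linarith
    · push Not at hq
      refine ⟨{a}, q ::ₘ Q, ?_, ?_, ?_, ?_⟩
      · simp [h1]
      · simp only [Multiset.sum_singleton]; exact (by linarith : a ≤ c).trans (le_max_left _ _)
      · intro r hr
        rcases Multiset.mem_cons.1 hr with rfl | hr
        · exact h2
        · exact h3 r hr
      · simp only [Multiset.sum_singleton, Multiset.card_cons, Multiset.sum_cons]
        push_cast
        linarith

lemma rb_pack (c d : ℝ) (hc : 0 < c) (hd : d < c) (L : Multiset ℝ)
    (hL : ∀ x ∈ L, 0 < x ∧ x ≤ d) :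
    ∃ Q : Multiset (Multiset ℝ), Q.join = L ∧ (∀ r ∈ Q, r.sum ≤ c) ∧
      (Q.card : ℤ) ≤ ⌈d / (c - d) * (L.card : ℝ)⌉ := by
  obtain ⟨q, Q, h1, h2, h3, h4⟩ := rb_greedy c d hd L hL
  rw [max_eq_left hc.le] at h2 h3
  have hs : L.sum ≤ L.card * d := by
    have := Multiset.sum_le_card_nsmul L d (fun x hx => (hL x hx).2)
    simpa [nsmul_eq_mul] using this
  have hcd : 0 < c - d := by linarith
  by_cases hq : q = 0
  · subst hq
    refine ⟨Q, by simpa using h1, h3, ?_⟩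
    have : (Q.card : ℝ) ≤ d / (c - d) * (L.card : ℝ) := by
      rw [div_mul_eq_mul_div, le_div_iff₀ hcd]
      simp only [Multiset.sum_zero] at h4
      linarith
    have h5 := this.trans (Int.le_ceil _)
    exact_mod_cast h5
  · refine ⟨q ::ₘ Q, by simpa using h1, ?_, ?_⟩
    · intro r hr
      rcases Multiset.mem_cons.1 hr with rfl | hr
      · exact h2
      · exact h3 r hr
    · have hqpos : 0 < q.sum := by
        obtain ⟨a, ha⟩ := Multiset.exists_mem_of_ne_zero hq
        have hqL : ∀ x ∈ q, 0 < x := fun x hx =>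
          (hL x (by rw [← h1]; exact Multiset.mem_add.2 (Or.inl hx))).1
        exact lt_of_lt_of_le (hqL a ha)
          (Multiset.single_le_sum (fun x hx => (hqL x hx).le) a ha)
      have : (Q.card : ℝ) < d / (c - d) * (L.card : ℝ) := by
        rw [div_mul_eq_mul_div, lt_div_iff₀ hcd]
        linarith
      have h5 := this.trans_le (Int.le_ceil _)
      have h6 : (Q.card : ℤ) < ⌈d / (c - d) * (L.card : ℝ)⌉ := by exact_mod_cast h5
      rw [Multiset.card_cons]; push_cast; omega

lemma rb_lower (k : ℕ) (s w : Fin k → ℝ) (η δ : ℝ) (hη : 0 < η) (hs : ∀ i, s i ≤ 1)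
    (hw : ∀ i, η ≤ w i) (P : Multiset (Fin k × Multiset ℝ))
    (hP : ∀ p ∈ P, p.2.sum ≤ s p.1) (hδ : ∀ p ∈ P, ∀ x ∈ p.2, δ ≤ x) :
    η * δ * ((P.map Prod.snd).join.card : ℝ) ≤ (P.map (fun p => w p.1)).sum := by
  induction P using Multiset.induction_on with
  | empty => simp
  | cons p P ih =>
    have ih := ih (fun p hp => hP p (Multiset.mem_cons_of_mem hp))
      (fun p hp => hδ p (Multiset.mem_cons_of_mem hp))
    have h1 := Multiset.card_nsmul_le_sum (hδ p (Multiset.mem_cons_self p P))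
    rw [nsmul_eq_mul] at h1
    have h2 : (p.2.card : ℝ) * δ ≤ 1 :=
      h1.trans ((hP p (Multiset.mem_cons_self p P)).trans (hs _))
    have h3 := hw p.1
    simp only [Multiset.map_cons, Multiset.join_cons, Multiset.card_add, Multiset.sum_cons]
    push_cast
    nlinarith [mul_le_mul_of_nonneg_left h2 hη.le]

theorem drop_small_items_related_bins (c η : ℝ)
    (hc : 0 < c ∧ c ≤ 1) (hη : 0 < η ∧ η ≤ 1)
    (k : ℕ) (hk : 1 ≤ k) (s w : Fin k → ℝ)
    (hs : ∀ i, c ≤ s i ∧ s i ≤ 1) (hw : ∀ i, η ≤ w i ∧ w i ≤ 1)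
    (δ₁ δ₂ ε₁ : ℝ) (hδ₁ : 0 < δ₁) (hδ₁₂ : δ₁ ≤ δ₂) (hδ₂ : δ₂ < c) (hε₁ : 0 < ε₁)
    (S : Multiset ℝ) (hS : ∀ x ∈ S, 0 < x ∧ x ≤ 1)
    (hprop : ((⌈δ₂ / (c - δ₂) * ((S.filter (fun a => a ≤ δ₂)).card : ℝ)⌉ : ℤ) : ℝ) ≤
      ε₁ * η * δ₁ * ((S.filter (fun a => δ₁ ≤ a)).card : ℝ)) :
    relOpt k s w (S.filter (fun a => δ₁ ≤ a)) ≤ relOpt k s w S ∧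
    relOpt k s w S ≤
      ENNReal.ofReal (1 + ε₁) * relOpt k s w (S.filter (fun a => δ₁ ≤ a)) + 1 := by
  have hsplit : S.filter (fun a => δ₁ ≤ a) + S.filter (fun a => ¬ δ₁ ≤ a) = S :=
    Multiset.filter_add_not _ _
  constructor
  · refine le_sInf ?_
    rintro x ⟨P, ⟨hP1, hP2⟩, rfl⟩
    refine sInf_le ⟨P.map (fun p => (p.1, p.2.filter (fun a => δ₁ ≤ a))), ⟨?_, ?_⟩, ?_⟩
    · rw [← hP1, ← rb_filter_join]
      simp [Multiset.map_map, Function.comp_def]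
    · intro p hp
      obtain ⟨q, hq, rfl⟩ := Multiset.mem_map.1 hp
      refine (rb_filter_sum_le _ _ ?_).trans (hP2 q hq)
      intro x hx
      refine (hS x ?_).1
      rw [← hP1]
      exact Multiset.mem_join.2 ⟨q.2, Multiset.mem_map_of_mem _ hq, hx⟩
    · simp [Multiset.map_map, Function.comp_def]
  · refine le_trans ?_ le_self_add
    have ha0 : ENNReal.ofReal (1 + ε₁) ≠ 0 := by
      rw [Ne, ENNReal.ofReal_eq_zero]; linarith
    rw [mul_comm, ← ENNReal.div_le_iff ha0 ENNReal.ofReal_ne_top]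
    refine le_sInf ?_
    rintro x ⟨P, ⟨hP1, hP2⟩, rfl⟩
    rw [ENNReal.div_le_iff ha0 ENNReal.ofReal_ne_top, mul_comm,
      ← ENNReal.ofReal_mul (by linarith)]
    obtain ⟨Q, hQ1, hQ2, hQ3⟩ := rb_pack c δ₂ hc.1 hδ₂ (S.filter (fun a => ¬ δ₁ ≤ a)) (by
      intro x hx
      obtain ⟨h1, h2⟩ := Multiset.mem_filter.1 hx
      exact ⟨(hS x h1).1, by linarith⟩)
    have hlow := rb_lower k s w η δ₁ hη.1 (fun i => (hs i).2) (fun i => (hw i).1) P hP2 (by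
      intro p hp x hx
      have : x ∈ S.filter (fun a => δ₁ ≤ a) := by
        rw [← hP1]
        exact Multiset.mem_join.2 ⟨p.2, Multiset.mem_map_of_mem _ hp, hx⟩
      exact (Multiset.mem_filter.1 this).2)
    rw [hP1] at hlow
    have hcard : (S.filter (fun a => ¬ δ₁ ≤ a)).card ≤ (S.filter (fun a => a ≤ δ₂)).card :=
      Multiset.card_le_card (Multiset.monotone_filter_right S (fun x hx => by
        simp only [not_le] at hx; linarith))
    have hcard' : (S.filter (fun a => ¬ δ₁ ≤ a)).card ≤ ((S.filter (fun a => a ≤ δ₂)).card : ℝ) := by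
      exact_mod_cast hcard
    have hX : 0 ≤ δ₂ / (c - δ₂) := div_nonneg (by linarith) (by linarith)
    have hQ4 : (Q.card : ℝ) ≤ ε₁ * η * δ₁ * ((S.filter (fun a => δ₁ ≤ a)).card : ℝ) := by
      refine le_trans ?_ hprop
      have := hQ3.trans (Int.ceil_le_ceil (mul_le_mul_of_nonneg_left hcard' hX))
      exact_mod_cast this
    let i0 : Fin k := ⟨0, hk⟩
    have hle : relOpt k s w S ≤ ENNReal.ofReal
        (((P + Q.map (fun q => (i0, q))).map (fun p => w p.1)).sum) := by
      refine sInf_le ⟨_, ⟨?_, ?_⟩, rfl⟩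
      · rw [Multiset.map_add, Multiset.join_add, hP1, Multiset.map_map]
        simp only [Function.comp_def, Multiset.map_id']
        rw [hQ1, hsplit]
      · intro p hp
        rcases Multiset.mem_add.1 hp with hp | hp
        · exact hP2 p hp
        · obtain ⟨q, hq, rfl⟩ := Multiset.mem_map.1 hp
          exact (hQ2 q hq).trans (hs i0).1
    refine hle.trans (ENNReal.ofReal_le_ofReal ?_)
    rw [Multiset.map_add, Multiset.sum_add, Multiset.map_map]
    simp only [Function.comp_def, Multiset.map_const', Multiset.sum_replicate, nsmul_eq_mul]
    have h1 : (Q.card : ℝ) * w i0 ≤ Q.card := mul_le_of_le_one_right (by positivity) (hw i0).2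
    have h2 := mul_le_mul_of_nonneg_left hlow hε₁.le
    linarith
end
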